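/- arXiv:1107.0381 — 2 statements merged into one kernel-verified Lean document; each statement's English description precedes it below -/
import Mathlib

section
/- For all real numbers x and all positive integers n, the sum ∑_{j=1}^{n} |sin(j x)|/j is strictly less than (2/π) log n + (2/π)(γ + log 2 + 3/n), where γ is the Euler–Mascheroni constant. -/
open Real

/-- The Fourier coefficients of `|sin|`, viewed as a function of period `π`. -/
theorem integral_exp_mul_abs_sin (n : ℤ) :
    ∫ t in (0 : ℝ)..π, Complex.exp (-(2 * n * Complex.I) * t) * ((|Real.sin t| : ℝ) : ℂ) =
      2 / (1 - 4 * (n : ℂ) ^ 2) := by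
  have hne : (1 - 4 * (n : ℂ) ^ 2) ≠ 0 := by
    have h : (1 - 4 * n ^ 2 : ℤ) ≠ 0 := by omega
    exact_mod_cast h
  set a : ℂ := -(2 * n * Complex.I) with ha
  have ha2 : a * a = -(4 * (n : ℂ) ^ 2) := by
    rw [ha]
    linear_combination 4 * (n : ℂ) ^ 2 * Complex.I_mul_I
  have hexp : Complex.exp (a * π) = 1 := by
    rw [Complex.exp_eq_one_iff]
    exact ⟨-n, by rw [ha]; push_cast; ring⟩
  have hcongr : ∫ t in (0 : ℝ)..π, Complex.exp (a * t) * ((|Real.sin t| : ℝ) : ℂ) =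
      ∫ t in (0 : ℝ)..π, Complex.exp (a * t) * Complex.sin t := by
    refine intervalIntegral.integral_congr fun t ht => ?_
    rw [Set.uIcc_of_le pi_pos.le] at ht
    rw [abs_of_nonneg (Real.sin_nonneg_of_mem_Icc ht), Complex.ofReal_sin]
  have hderiv (t : ℝ) : HasDerivAt
      (fun s : ℝ => Complex.exp (a * s) * (a * Complex.sin s - Complex.cos s) /
        (1 - 4 * (n : ℂ) ^ 2))
      (Complex.exp (a * t) * Complex.sin t) t := by
    have h1 : HasDerivAt (fun s : ℂ => Complex.exp (a * s)) (Complex.exp (a * t) * (a * 1)) t :=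
      ((hasDerivAt_id (t : ℂ)).const_mul a).cexp
    have h2 := ((Complex.hasDerivAt_sin (t : ℂ)).const_mul a).sub (Complex.hasDerivAt_cos (t : ℂ))
    convert! ((h1.mul h2).div_const (1 - 4 * (n : ℂ) ^ 2)).comp_ofReal using 1
    rw [eq_div_iff hne]
    simp only [Pi.sub_apply]
    linear_combination -Complex.exp (a * t) * Complex.sin t * ha2
  rw [hcongr, intervalIntegral.integral_eq_sub_of_hasDerivAt (fun t _ => hderiv t)
    (Continuous.intervalIntegrable (by fun_prop) _ _), hexp]
  simp
  ring

/-- The Fourier series of `|sin|`. -/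
theorem hasSum_abs_sin (θ : ℝ) :
    HasSum (fun n : ℤ => 2 / π * (1 / (1 - 4 * (n : ℝ) ^ 2)) * Real.cos (n * (2 * θ)))
      |Real.sin θ| := by
  have : Fact (0 < π) := ⟨pi_pos⟩
  have hper : Function.Periodic (fun t : ℝ => ((|Real.sin t| : ℝ) : ℂ)) π := fun t => by
    simp [Real.sin_add_pi]
  let F : C(AddCircle π, ℂ) := ⟨hper.lift, continuous_coinduced_dom.mpr
    (show Continuous (fun t : ℝ => ((|Real.sin t| : ℝ) : ℂ)) by fun_prop)⟩
  have hFcoe (t : ℝ) : F (t : AddCircle π) = ((|Real.sin t| : ℝ) : ℂ) := rfl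
  have hcoeff (n : ℤ) : fourierCoeff F n =
      ((2 / π * (1 / (1 - 4 * (n : ℝ) ^ 2)) : ℝ) : ℂ) := by
    rw [fourierCoeff_eq_intervalIntegral _ n 0, zero_add]
    have : ∫ t in (0 : ℝ)..π, fourier (-n) (t : AddCircle π) • F (t : AddCircle π) =
        ∫ t in (0 : ℝ)..π, Complex.exp (-(2 * n * Complex.I) * t) * ((|Real.sin t| : ℝ) : ℂ) := by
      refine intervalIntegral.integral_congr fun t _ => ?_
      rw [fourier_coe_apply, hFcoe, smul_eq_mul]
      congr 2
      have : (π : ℂ) ≠ 0 := by exact_mod_cast pi_ne_zero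
      push_cast
      field_simp
    rw [this, integral_exp_mul_abs_sin, Complex.real_smul]
    push_cast
    ring
  have hsummable : Summable (fourierCoeff F) := by
    refine Summable.congr ?_ (fun n => (hcoeff n).symm)
    refine Complex.ofRealCLM.summable (Summable.mul_left _ ?_)
    refine Summable.of_norm_bounded_eventually
      (Real.summable_one_div_int_pow.mpr one_lt_two) ?_
    filter_upwards [(Set.finite_singleton (0 : ℤ)).compl_mem_cofinite] with n hn
    have h1 : (1 : ℝ) ≤ (n : ℝ) ^ 2 := by
      exact_mod_cast (one_le_sq_iff_one_le_abs n).mpr (Int.one_le_abs hn)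
    rw [norm_div, norm_one, Real.norm_eq_abs, abs_of_nonpos (by linarith)]
    exact one_div_le_one_div_of_le (by linarith) (by linarith)
  have hsum := has_pointwise_sum_fourier_series_of_summable hsummable (θ : AddCircle π)
  rw [hFcoe] at hsum
  have hre := Complex.hasSum_re hsum
  rw [Complex.ofReal_re] at hre
  convert! hre using 2 with n
  rw [hcoeff, fourier_coe_apply, smul_eq_mul, Complex.re_ofReal_mul]
  have harg : 2 * (π : ℂ) * Complex.I * n * θ / π = ((n * (2 * θ) : ℝ) : ℂ) * Complex.I := by
    have : (π : ℂ) ≠ 0 := by exact_mod_cast pi_ne_zero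
    push_cast
    field_simp
  rw [harg, Complex.exp_ofReal_mul_I_re]

theorem two_sin_half_mul_sum_sin (n : ℕ) (x : ℝ) :
    2 * Real.sin (x / 2) * ∑ j ∈ Finset.Icc 1 n, Real.sin (j * x) =
      Real.cos (x / 2) - Real.cos ((n + 1 / 2) * x) := by
  induction n with
  | zero => simp; ring_nf
  | succ k ih =>
    rw [Finset.sum_Icc_succ_top (by omega), mul_add, ih]
    have h1 : ((k : ℝ) + 1 / 2) * x = ((k + 1 : ℕ) : ℝ) * x - x / 2 := by push_cast; ring
    have h2 : (((k + 1 : ℕ) : ℝ) + 1 / 2) * x = ((k + 1 : ℕ) : ℝ) * x + x / 2 := by ring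
    rw [h1, h2, Real.cos_sub, Real.cos_add]
    ring

theorem sum_cos_nat_mul_pi_div_two_mul (m : ℕ) :
    ∑ j ∈ Finset.Icc 1 (2 * m), Real.cos (j * π) / j =
      (harmonic m : ℝ) - harmonic (2 * m) := by
  induction m with
  | zero => simp
  | succ k ih =>
    rw [show 2 * (k + 1) = 2 * k + 1 + 1 by ring, Finset.sum_Icc_succ_top (by omega),
      Finset.sum_Icc_succ_top (by omega), ih, harmonic_succ, harmonic_succ, harmonic_succ]
    simp only [Real.cos_nat_mul_pi, pow_succ, pow_mul]
    push_cast
    field_simp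
    ring

theorem harmonic_two_mul_sub_le (m : ℕ) :
    (harmonic (2 * m) : ℝ) - harmonic m ≤ Real.log 2 := by
  rcases m.eq_zero_or_pos with rfl | hm
  · simpa using Real.log_nonneg one_le_two
  · have h := Real.strictAnti_eulerMascheroniSeq'.antitone (show m ≤ 2 * m by omega)
    simp only [Real.eulerMascheroniSeq', hm.ne', mul_eq_zero, OfNat.ofNat_ne_zero, or_self,
      if_false] at h
    have hm' : (m : ℝ) ≠ 0 := by exact_mod_cast hm.ne'
    rw [Nat.cast_mul, Nat.cast_ofNat, Real.log_mul two_ne_zero hm'] at h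
    linarith

theorem sum_cos_nat_mul_pi_div_ge {n : ℕ} (hn : 0 < n) :
    -Real.log 2 - 1 / n ≤ ∑ j ∈ Finset.Icc 1 n, Real.cos (j * π) / j := by
  rcases Nat.even_or_odd' n with ⟨m, rfl | rfl⟩
  · rw [sum_cos_nat_mul_pi_div_two_mul]
    have := harmonic_two_mul_sub_le m
    have : (0 : ℝ) ≤ 1 / ((2 * m : ℕ) : ℝ) := by positivity
    linarith
  · rw [Finset.sum_Icc_succ_top (by omega), sum_cos_nat_mul_pi_div_two_mul,
      Real.cos_nat_mul_pi]
    have := harmonic_two_mul_sub_le m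
    simp only [pow_succ, pow_mul]
    norm_num [neg_div]
    linarith

theorem sum_cos_div_ge_sub_log_sin (n : ℕ) {x : ℝ} (hx0 : 0 < x) (hxπ : x ≤ π) :
    ∑ j ∈ Finset.Icc 1 n, Real.cos (j * π) / j - Real.log (Real.sin (x / 2)) -
      1 / ((n + 1 / 2) * Real.sin (x / 2)) ≤ ∑ j ∈ Finset.Icc 1 n, Real.cos (j * x) / j := by
  set N : ℝ := n + 1 / 2 with hN
  have hNpos : 0 < N := by positivity
  have hs (t : ℝ) (ht : t ∈ Set.Icc x π) : 0 < Real.sin (t / 2) :=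
    Real.sin_pos_of_pos_of_lt_pi (by linarith [ht.1]) (by linarith [ht.2, pi_pos])
  let K : ℝ → ℝ := fun t => ∑ j ∈ Finset.Icc 1 n, Real.cos (j * t) / j +
    Real.log (Real.sin (t / 2)) + (1 - Real.sin (N * t)) / (2 * N * Real.sin (t / 2))
  have hK (t : ℝ) (ht : t ∈ Set.Icc x π) : HasDerivAt K
      (-(Real.cos (t / 2) * (1 - Real.sin (N * t)) / (4 * N * Real.sin (t / 2) ^ 2))) t := by
    have hst := hs t ht
    have h1 : HasDerivAt (fun t : ℝ => ∑ j ∈ Finset.Icc 1 n, Real.cos (j * t) / j)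
        (∑ j ∈ Finset.Icc 1 n, -Real.sin (j * t)) t := by
      refine HasDerivAt.fun_sum fun j hj => ?_
      have hj : (j : ℝ) ≠ 0 := by
        have := (Finset.mem_Icc.mp hj).1
        positivity
      convert! (((hasDerivAt_id t).const_mul (j : ℝ)).cos).div_const (j : ℝ) using 1
      simp only [id]
      field_simp
    have h2 : HasDerivAt (fun t : ℝ => Real.sin (t / 2)) (Real.cos (t / 2) * (1 / 2)) t :=
      ((hasDerivAt_id t).div_const 2).sin
    have h3 : HasDerivAt (fun t : ℝ => Real.sin (N * t)) (Real.cos (N * t) * (N * 1)) t :=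
      ((hasDerivAt_id t).const_mul N).sin
    convert! (h1.add (h2.log hst.ne')).add
      ((h3.const_sub 1).div (h2.const_mul (2 * N)) (by positivity)) using 1
    have hD := two_sin_half_mul_sum_sin n t
    rw [← hN] at hD
    have hD' : ∑ j ∈ Finset.Icc 1 n, -Real.sin (j * t) =
        -((Real.cos (t / 2) - Real.cos (N * t)) / (2 * Real.sin (t / 2))) := by
      rw [Finset.sum_neg_distrib, ← hD, mul_div_cancel_left₀ _ (by positivity)]
    rw [hD']
    field_simp
    ring
  have hanti : AntitoneOn K (Set.Icc x π) := by
    refine antitoneOn_of_deriv_nonpos (convex_Icc _ _)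
      (fun t ht => (hK t ht).continuousAt.continuousWithinAt)
      (fun t ht => (hK t (interior_subset ht)).differentiableAt.differentiableWithinAt)
      (fun t ht => ?_)
    have ht := interior_subset ht
    rw [(hK t ht).deriv]
    have hst := hs t ht
    have hc : 0 ≤ Real.cos (t / 2) :=
      Real.cos_nonneg_of_mem_Icc ⟨by linarith [ht.1, pi_pos], by linarith [ht.2]⟩
    have h1 : 0 ≤ 1 - Real.sin (N * t) := by linarith [Real.sin_le_one (N * t)]
    have : 0 ≤ Real.cos (t / 2) * (1 - Real.sin (N * t)) / (4 * N * Real.sin (t / 2) ^ 2) := by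
      positivity
    linarith
  have hle := hanti (Set.left_mem_Icc.mpr hxπ) (Set.right_mem_Icc.mpr hxπ) hxπ
  have hsx := hs x (Set.left_mem_Icc.mpr hxπ)
  simp only [K, Real.sin_pi_div_two, Real.log_one] at hle
  have hπ : 0 ≤ (1 - Real.sin (N * π)) / (2 * N * 1) :=
    div_nonneg (by linarith [Real.sin_le_one (N * π)]) (by positivity)
  have hx : (1 - Real.sin (N * x)) / (2 * N * Real.sin (x / 2)) ≤
      1 / (N * Real.sin (x / 2)) := by
    rw [div_le_div_iff₀ (by positivity) (by positivity)]
    have : 0 < N * Real.sin (x / 2) := by positivity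
    nlinarith [Real.neg_one_le_sin (N * x)]
  linarith

theorem log_add_one_div_le {n : ℕ} (hn : 0 < n) {s : ℝ} (hs : 1 / (2 * n) ≤ s) (hs1 : s ≤ 1) :
    Real.log s + 1 / ((n + 1 / 2) * s) ≤ 1 / n := by
  have hn' : (1 : ℝ) ≤ n := by exact_mod_cast hn
  have hspos : 0 < s := lt_of_lt_of_le (by positivity) hs
  have hconc : ConcaveOn ℝ (Set.Ioi 0) (fun u : ℝ => Real.log u + u * (-(1 / (n + 1 / 2)))) := by
    refine strictConcaveOn_log_Ioi.concaveOn.add ?_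
    exact ((LinearMap.mulRight ℝ (-(1 / ((n : ℝ) + 1 / 2)))).concaveOn (convex_Ioi _))
  have hu : s⁻¹ ∈ Set.Icc (1 : ℝ) (2 * n) :=
    ⟨(one_le_inv₀ hspos).mpr hs1, by
      rw [inv_le_comm₀ hspos (by positivity)]; simpa using hs⟩
  have hmin := hconc.min_le_of_mem_Icc (Set.mem_Ioi.mpr one_pos)
    (Set.mem_Ioi.mpr (by positivity)) hu
  have hleft : -(1 / (n : ℝ)) ≤ Real.log 1 + 1 * (-(1 / (n + 1 / 2))) := by
    have : 1 / ((n : ℝ) + 1 / 2) ≤ 1 / n := one_div_le_one_div_of_le (by positivity) (by linarith)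
    rw [Real.log_one]
    linarith
  have hright : -(1 / (n : ℝ)) ≤ Real.log (2 * n) + 2 * n * (-(1 / (n + 1 / 2))) := by
    have h1 := Real.one_sub_inv_le_log_of_pos (x := 2 * n / Real.exp 1) (by positivity)
    rw [Real.log_div (by positivity) (by positivity), Real.log_exp, inv_div] at h1
    have h2 : Real.exp 1 / (2 * n) ≤ 1.36 / n := by
      rw [div_le_div_iff₀ (by positivity) (by positivity)]
      nlinarith [Real.exp_one_lt_d9]
    have h3 : 1.36 / (n : ℝ) ≤ 1 / n + 1 / (n + 1 / 2) := by
      rw [div_add_div _ _ (by positivity) (by positivity),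
        div_le_div_iff₀ (by positivity) (by positivity)]
      nlinarith
    have h4 : 2 * n * (-(1 / ((n : ℝ) + 1 / 2))) = -2 + 1 / (n + 1 / 2) := by
      field_simp
      ring
    linarith
  have hfin := (le_min hleft hright).trans hmin
  simp only [Real.log_inv] at hfin
  have : 1 / (((n : ℝ) + 1 / 2) * s) = s⁻¹ * (1 / (n + 1 / 2)) := by
    rw [one_div, mul_inv]; ring
  rw [this]
  linarith

theorem sum_cos_div_ge_of_mem_Icc {n : ℕ} (hn : 0 < n) {x : ℝ} (hx : x ∈ Set.Icc 0 π) :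
    -Real.log 2 - 2 / n ≤ ∑ j ∈ Finset.Icc 1 n, Real.cos (j * x) / j := by
  have hn' : (0 : ℝ) < n := by exact_mod_cast hn
  rcases le_total x (π / (2 * n)) with hsmall | hlarge
  · have h0 : 0 ≤ ∑ j ∈ Finset.Icc 1 n, Real.cos (j * x) / j := by
      refine Finset.sum_nonneg fun j hj => div_nonneg ?_ (Nat.cast_nonneg j)
      have hjn : (j : ℝ) ≤ n := by exact_mod_cast (Finset.mem_Icc.mp hj).2
      have h1 : (j : ℝ) * x ≤ n * (π / (2 * n)) := by
        gcongr
        exact hx.1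
      have h2 : (n : ℝ) * (π / (2 * n)) = π / 2 := by field_simp
      have h3 : 0 ≤ (j : ℝ) * x := mul_nonneg (Nat.cast_nonneg j) hx.1
      exact Real.cos_nonneg_of_mem_Icc ⟨by linarith [pi_pos], by linarith⟩
    have : 0 < Real.log 2 := Real.log_pos one_lt_two
    have : 0 < 2 / (n : ℝ) := by positivity
    linarith
  · have hx0 : 0 < x := lt_of_lt_of_le (by positivity) hlarge
    have hs : 1 / (2 * (n : ℝ)) ≤ Real.sin (x / 2) := by
      have h1 := Real.mul_le_sin (x := x / 2) (by linarith) (by linarith [hx.2])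
      refine le_trans ?_ h1
      calc 1 / (2 * (n : ℝ)) = 2 / π * (π / (2 * n) / 2) := by field_simp
        _ ≤ 2 / π * (x / 2) := by gcongr
    have h1 := log_add_one_div_le hn hs (Real.sin_le_one _)
    have h2 := sum_cos_div_ge_sub_log_sin n hx0 hx.2
    have h3 := sum_cos_nat_mul_pi_div_ge hn
    have h4 : 2 / (n : ℝ) = 1 / n + 1 / n := by ring
    linarith

theorem sum_cos_div_ge {n : ℕ} (hn : 0 < n) (x : ℝ) :
    -Real.log 2 - 2 / n ≤ ∑ j ∈ Finset.Icc 1 n, Real.cos (j * x) / j := by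
  have hcos (j : ℕ) : Real.cos (j * x) = Real.cos (j * Real.arccos (Real.cos x)) := by
    have h1 := Polynomial.Chebyshev.T_real_cos x j
    have h2 := Polynomial.Chebyshev.T_real_cos (Real.arccos (Real.cos x)) j
    rw [Real.cos_arccos (Real.neg_one_le_cos x) (Real.cos_le_one x), h1] at h2
    exact_mod_cast h2
  simp_rw [hcos]
  exact sum_cos_div_ge_of_mem_Icc hn ⟨Real.arccos_nonneg _, Real.arccos_le_pi _⟩

theorem harmonic_lt_log_add {n : ℕ} (hn : 0 < n) :
    (harmonic n : ℝ) < Real.log n + Real.eulerMascheroniConstant + 1 / n := by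
  have hn' : (0 : ℝ) < n := by exact_mod_cast hn
  have h1 := Real.eulerMascheroniSeq_lt_eulerMascheroniConstant n
  rw [Real.eulerMascheroniSeq] at h1
  have h2 := Real.log_le_sub_one_of_pos (x := (n + 1) / n) (by positivity)
  rw [Real.log_div (by positivity) (by positivity)] at h2
  have h3 : ((n : ℝ) + 1) / n - 1 = 1 / n := by field_simp; ring
  linarith

theorem sum_abs_sin_div_le {n : ℕ} (hn : 0 < n) (x : ℝ) :
    ∑ j ∈ Finset.Icc 1 n, |Real.sin (j * x)| / j ≤
      2 / π * (harmonic n + Real.log 2 + 2 / n) := by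
  have hzero : HasSum (fun m : ℤ => 2 / π * (1 / (1 - 4 * (m : ℝ) ^ 2))) 0 := by
    simpa using hasSum_abs_sin 0
  set L := Real.log 2 + 2 / (n : ℝ) with hL
  have hsum : HasSum (fun m : ℤ => ∑ j ∈ Finset.Icc 1 n,
      2 / π * (1 / (1 - 4 * (m : ℝ) ^ 2)) * Real.cos (m * (2 * (j * x))) / j)
      (∑ j ∈ Finset.Icc 1 n, |Real.sin (j * x)| / j) :=
    hasSum_sum fun j _ => (hasSum_abs_sin (j * x)).div_const (j : ℝ)
  have hbound : HasSum (fun m : ℤ => (if m = 0 then 2 / π * (harmonic n + L) else 0) +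
      2 / π * (1 / (1 - 4 * (m : ℝ) ^ 2)) * (-L)) (2 / π * (harmonic n + L) + 0 * (-L)) :=
    (hasSum_ite_eq 0 _).add (hzero.mul_right _)
  refine (hasSum_le (fun m => ?_) hsum hbound).trans_eq (by rw [hL]; ring)
  rcases eq_or_ne m 0 with rfl | hm
  · have : (harmonic n : ℝ) = ∑ j ∈ Finset.Icc 1 n, (1 : ℝ) / j := by
      rw [harmonic_eq_sum_Icc]; simp
    rw [this]
    simp only [Int.cast_zero, zero_mul, Real.cos_zero, if_true, mul_div_assoc, ← Finset.mul_sum]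
    apply le_of_eq
    ring
  · have hf := sum_cos_div_ge hn (2 * m * x)
    have hw : 2 / π * (1 / (1 - 4 * (m : ℝ) ^ 2)) ≤ 0 := by
      have h1 : (1 : ℝ) ≤ (m : ℝ) ^ 2 := by
        exact_mod_cast (one_le_sq_iff_one_le_abs m).mpr (Int.one_le_abs hm)
      exact mul_nonpos_of_nonneg_of_nonpos (by positivity)
        (one_div_nonpos.mpr (by linarith))
    rw [if_neg hm, zero_add]
    calc ∑ j ∈ Finset.Icc 1 n,
          2 / π * (1 / (1 - 4 * (m : ℝ) ^ 2)) * Real.cos (m * (2 * (j * x))) / j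
        = 2 / π * (1 / (1 - 4 * (m : ℝ) ^ 2)) *
          ∑ j ∈ Finset.Icc 1 n, Real.cos (j * (2 * m * x)) / j := by
          rw [Finset.mul_sum]
          refine Finset.sum_congr rfl fun j _ => ?_
          rw [mul_div_assoc]
          ring_nf
      _ ≤ 2 / π * (1 / (1 - 4 * (m : ℝ) ^ 2)) * (-L) :=
          mul_le_mul_of_nonpos_left (by rw [hL]; linarith) hw

theorem polya_vinogradov_sin_lemma (x : ℝ) (n : ℕ) (hn : 0 < n) :
    ∑ j ∈ Finset.Icc 1 n, |Real.sin (j * x)| / j <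
      2 / π * Real.log n + 2 / π * (Real.eulerMascheroniConstant + Real.log 2 + 3 / n) := by
  refine (sum_abs_sin_div_le hn x).trans_lt ?_
  rw [← mul_add]
  refine mul_lt_mul_of_pos_left ?_ (by positivity)
  have h1 := harmonic_lt_log_add hn
  have h2 : 3 / (n : ℝ) = 2 / n + 1 / n := by ring
  linarith
end

section
/- For every u ∈ [0,1] and every real P > 1, |S(u;P)| ≤ (C₀/(2π²)) G_P(u), where S(u;P) = ∑_{m=1}^{∞} (1/m) ω(m/P) sin(2π m u), ω(t) = 0 for 0 < t ≤ 1/2, ω(t) = 2t−1 for 1/2 ≤ t ≤ 1, ω(t) = 1 for t ≥ 1, G_P(u) = ∑_{n ∈ ℤ} 1/(1+P²(n+u)²), and C₀ = 4π^{5/2} + 5. -/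
open Real Filter

/-- The smoothed cutoff function ω. -/
noncomputable def ωcut (t : ℝ) : ℝ :=
  if t ≤ 1 / 2 then 0 else if t ≤ 1 then 2 * t - 1 else 1

/-- The periodized Cauchy kernel. -/
noncomputable def GP (P u : ℝ) : ℝ := ∑' n : ℤ, 1 / (1 + P ^ 2 * ((n : ℝ) + u) ^ 2)

/-- The increasing convex function `t ↦ 4 (t - 1/2)₊ + (t - 1)₊² / t` on `[0, ∞)`. -/
noncomputable def convexPos (t : ℝ) : ℝ :=
  4 * max t (1 / 2) - 2 + (max t 1 + 1 / max t 1 - 2)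

/-- The increasing convex function with `ωcut t / t = convexPos t - convexNeg t`. -/
noncomputable def convexNeg (t : ℝ) : ℝ :=
  4 * max t (1 / 2) - 4 + max (1 / max t (1 / 2)) (max t (1 / 2))

lemma add_inv_mono {x y : ℝ} (hx : 1 ≤ x) (hxy : x ≤ y) : x + 1 / x ≤ y + 1 / y := by
  have hx0 : 0 < x := by linarith
  have hy0 : 0 < y := by linarith
  have h : y + 1 / y - (x + 1 / x) = (y - x) * (x * y - 1) / (x * y) := by
    field_simp
    ring
  have : 0 ≤ (y - x) * (x * y - 1) / (x * y) := by
    apply div_nonneg _ (by positivity)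
    apply mul_nonneg <;> nlinarith
  linarith

lemma four_mul_add_inv_mono {x y : ℝ} (hx : 1 / 2 ≤ x) (hxy : x ≤ y) :
    4 * x + 1 / x ≤ 4 * y + 1 / y := by
  have := add_inv_mono (x := 2 * x) (y := 2 * y) (by linarith) (by linarith)
  have hx0 : 0 < x := by linarith
  have hy0 : 0 < y := by linarith
  have e1 : 2 * (2 * x + 1 / (2 * x)) = 4 * x + 1 / x := by field_simp; ring
  have e2 : 2 * (2 * y + 1 / (2 * y)) = 4 * y + 1 / y := by field_simp; ring
  linarith

lemma two_mul_inv_midpoint_le {x y : ℝ} (hx : 0 < x) (hy : 0 < y) :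
    2 * (1 / ((x + y) / 2)) ≤ 1 / x + 1 / y := by
  have h : 1 / x + 1 / y - 2 * (1 / ((x + y) / 2)) = (x - y) ^ 2 / (x * y * (x + y)) := by
    field_simp
    ring
  have : 0 ≤ (x - y) ^ 2 / (x * y * (x + y)) := by positivity
  linarith

lemma two_mul_max_le (a b c d : ℝ) (h : 2 * b ≤ a + c) :
    2 * max b d ≤ max a d + max c d := by
  rcases max_choice b d with hb | hb <;> rw [hb] <;>
  linarith [le_max_left a d, le_max_right a d, le_max_left c d, le_max_right c d]

lemma convexPos_mono {s t : ℝ} (h : s ≤ t) : convexPos s ≤ convexPos t := by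
  have h1 := max_le_max_right (1 / 2) h
  have h2 := add_inv_mono (le_max_right s 1) (max_le_max_right 1 h)
  unfold convexPos
  linarith

lemma max_sub_max_le {s t : ℝ} (h : s ≤ t) (c : ℝ) : max t c - max s c ≤ t - s := by
  have : max t c ≤ max s c + (t - s) :=
    max_le (by linarith [le_max_left s c]) (by linarith [le_max_right s c])
  linarith

lemma convexPos_sub_le {s t : ℝ} (h : s ≤ t) : convexPos t - convexPos s ≤ 5 * (t - s) := by
  have h1 := max_sub_max_le h (1 / 2)
  have h2 := max_sub_max_le h 1
  have h3 : 1 / max t 1 ≤ 1 / max s 1 :=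
    one_div_le_one_div_of_le (by linarith [le_max_right s 1]) (max_le_max_right 1 h)
  unfold convexPos
  linarith

lemma convexPos_midpoint {r s t : ℝ} (h : 2 * s = r + t) :
    2 * convexPos s ≤ convexPos r + convexPos t := by
  have h1 := two_mul_max_le r s t (1 / 2) h.le
  have h2 := two_mul_max_le r s t 1 h.le
  have hr := le_max_right r 1
  have hs := le_max_right s 1
  have ht := le_max_right t 1
  have h3 := add_inv_mono (y := (max r 1 + max t 1) / 2) hs (by linarith)
  have h4 := two_mul_inv_midpoint_le (x := max r 1) (y := max t 1) (by linarith) (by linarith)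
  unfold convexPos
  linarith

lemma convexNeg_mono {s t : ℝ} (h : s ≤ t) : convexNeg s ≤ convexNeg t := by
  have h1 := max_le_max_right (1 / 2) h
  have h2 := four_mul_add_inv_mono (le_max_right s (1 / 2)) h1
  unfold convexNeg
  have h3 := le_max_left (1 / max t (1 / 2)) (max t (1 / 2))
  have h4 := le_max_right (1 / max t (1 / 2)) (max t (1 / 2))
  rcases max_choice (1 / max s (1 / 2)) (max s (1 / 2)) with hb | hb <;> rw [hb] <;> linarith

lemma convexNeg_sub_le {s t : ℝ} (h : s ≤ t) : convexNeg t - convexNeg s ≤ 5 * (t - s) := by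
  have h0 := max_le_max_right (1 / 2) h
  have h1 := max_sub_max_le h (1 / 2)
  have h2 : 1 / max t (1 / 2) ≤ 1 / max s (1 / 2) :=
    one_div_le_one_div_of_le (by linarith [le_max_right s (1 / 2)]) h0
  unfold convexNeg
  have h3 := le_max_left (1 / max s (1 / 2)) (max s (1 / 2))
  have h4 := le_max_right (1 / max s (1 / 2)) (max s (1 / 2))
  rcases max_choice (1 / max t (1 / 2)) (max t (1 / 2)) with hb | hb <;> rw [hb] <;> linarith

lemma convexNeg_midpoint {r s t : ℝ} (h : 2 * s = r + t) :
    2 * convexNeg s ≤ convexNeg r + convexNeg t := by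
  have h1 := two_mul_max_le r s t (1 / 2) h.le
  have hr := le_max_right r (1 / 2)
  have hs := le_max_right s (1 / 2)
  have ht := le_max_right t (1 / 2)
  have h3 := four_mul_add_inv_mono (y := (max r (1 / 2) + max t (1 / 2)) / 2) hs (by linarith)
  have h4 := two_mul_inv_midpoint_le (x := max r (1 / 2)) (y := max t (1 / 2))
    (by linarith) (by linarith)
  unfold convexNeg
  have h5 := le_max_left (1 / max t (1 / 2)) (max t (1 / 2))
  have h6 := le_max_right (1 / max t (1 / 2)) (max t (1 / 2))
  have h7 := le_max_left (1 / max r (1 / 2)) (max r (1 / 2))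
  have h8 := le_max_right (1 / max r (1 / 2)) (max r (1 / 2))
  rcases max_choice (1 / max s (1 / 2)) (max s (1 / 2)) with hb | hb <;> rw [hb] <;> linarith

lemma convexPos_sub_convexNeg (t : ℝ) :
    convexPos t - convexNeg t = ωcut t / t := by
  unfold convexPos convexNeg ωcut
  split_ifs with h1 h2
  · rw [max_eq_right h1, max_eq_right (by linarith : t ≤ 1), max_eq_left (by norm_num)]
    norm_num
  · have h0 : 0 < t := by linarith
    rw [max_eq_left (by linarith : 1 / 2 ≤ t), max_eq_right h2, max_eq_left]
    · field_simp
      ring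
    · rw [le_div_iff₀ h0]
      nlinarith
  · have h0 : 0 < t := by linarith
    rw [max_eq_left (by linarith : 1 / 2 ≤ t), max_eq_left (by linarith : 1 ≤ t), max_eq_right]
    · ring
    · rw [div_le_iff₀ h0]
      nlinarith

/-- The coefficient `ω(m/P)/m`. -/
noncomputable def cutCoeff (P : ℝ) (m : ℕ) : ℝ := 1 / (m : ℝ) * ωcut (m / P)

lemma cutCoeff_eq {P : ℝ} (hP : 0 < P) (m : ℕ) :
    cutCoeff P m = 1 / P * (convexPos (m / P) - convexNeg (m / P)) := by
  rw [convexPos_sub_convexNeg, cutCoeff]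
  rcases Nat.eq_zero_or_pos m with rfl | hm
  · simp
  · have : (0 : ℝ) < m := by exact_mod_cast hm
    field_simp

lemma ωcut_nonneg (t : ℝ) : 0 ≤ ωcut t := by
  unfold ωcut
  split_ifs <;> linarith

lemma ωcut_le_one (t : ℝ) : ωcut t ≤ 1 := by
  unfold ωcut
  split_ifs <;> linarith

lemma cutCoeff_nonneg (P : ℝ) (m : ℕ) : 0 ≤ cutCoeff P m :=
  mul_nonneg (by positivity) (ωcut_nonneg _)

lemma cutCoeff_le (P : ℝ) (m : ℕ) : cutCoeff P m ≤ 1 / m :=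
  mul_le_of_le_one_right (by positivity) (ωcut_le_one _)

lemma cutCoeff_of_le {P : ℝ} (hP : 0 < P) {m : ℕ} (hm : P ≤ m) : cutCoeff P m = 1 / m := by
  have h : 1 ≤ m / P := by rwa [le_div_iff₀ hP, one_mul]
  rw [cutCoeff, ωcut, if_neg (by linarith)]
  split_ifs with h2
  · rw [le_antisymm h2 h]
    norm_num
  · simp

lemma tendsto_cutCoeff (P : ℝ) : Tendsto (cutCoeff P) atTop (nhds 0) :=
  squeeze_zero (cutCoeff_nonneg P) (cutCoeff_le P) tendsto_one_div_atTop_nhds_zero_nat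

/-- The second difference of the coefficients, centred at `m + 1`. -/
noncomputable def secondDiff (P : ℝ) (m : ℕ) : ℝ :=
  cutCoeff P (m + 2) - 2 * cutCoeff P (m + 1) + cutCoeff P m

lemma sum_secondDiff (g : ℕ → ℝ) (N : ℕ) :
    ∑ m ∈ Finset.range N, (g (m + 2) - 2 * g (m + 1) + g m) = g (N + 1) - g N - (g 1 - g 0) := by
  have h := Finset.sum_range_sub (fun m => g (m + 1) - g m) N
  simp only [zero_add] at h
  rw [← h]
  exact Finset.sum_congr rfl fun m _ => by ring

lemma sum_abs_secondDiff_le {P : ℝ} (hP : 0 < P) (N : ℕ) :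
    ∑ m ∈ Finset.range N, |secondDiff P m| ≤ 10 / P ^ 2 := by
  have hmid (m : ℕ) : 2 * (((m + 1 : ℕ) : ℝ) / P) = (m : ℝ) / P + ((m + 2 : ℕ) : ℝ) / P := by
    push_cast
    ring
  have hstep (m : ℕ) : (m : ℝ) / P ≤ ((m + 1 : ℕ) : ℝ) / P := by
    gcongr
    exact_mod_cast Nat.le_succ m
  have hgap : ((N + 1 : ℕ) : ℝ) / P - (N : ℝ) / P = 1 / P := by
    push_cast
    ring
  have hle (m : ℕ) : |secondDiff P m| ≤ 1 / P *
      ((convexPos ((m + 2 : ℕ) / P) - 2 * convexPos ((m + 1 : ℕ) / P) + convexPos (m / P)) +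
      (convexNeg ((m + 2 : ℕ) / P) - 2 * convexNeg ((m + 1 : ℕ) / P) + convexNeg (m / P))) := by
    have h1 := convexPos_midpoint (hmid m)
    have h2 := convexNeg_midpoint (hmid m)
    have e : secondDiff P m = 1 / P *
      ((convexPos ((m + 2 : ℕ) / P) - 2 * convexPos ((m + 1 : ℕ) / P) + convexPos (m / P)) -
      (convexNeg ((m + 2 : ℕ) / P) - 2 * convexNeg ((m + 1 : ℕ) / P) + convexNeg (m / P))) := by
      simp only [secondDiff, cutCoeff_eq hP]
      ring
    rw [e, abs_mul, abs_of_pos (by positivity : 0 < 1 / P)]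
    gcongr
    rw [abs_le]
    constructor <;> linarith
  refine (Finset.sum_le_sum fun m _ => hle m).trans ?_
  rw [← Finset.mul_sum, Finset.sum_add_distrib,
    sum_secondDiff (fun m : ℕ => convexPos (m / P)),
    sum_secondDiff (fun m : ℕ => convexNeg (m / P))]
  have h1 := convexPos_sub_le (hstep N)
  have h2 := convexNeg_sub_le (hstep N)
  have h3 := convexPos_mono (hstep 0)
  have h4 := convexNeg_mono (hstep 0)
  rw [hgap] at h1 h2
  simp only [zero_add] at h3 h4
  have e : 10 / P ^ 2 = 1 / P * (10 * (1 / P)) := by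
    field_simp
  rw [e]
  gcongr
  linarith

lemma sum_by_parts_twice (a : ℕ → ℝ) (ha : a 0 = 0) (θ : ℝ) (N : ℕ) :
    (2 - 2 * cos θ) * ∑ m ∈ Finset.Icc 1 N, a m * sin (m * θ) =
      -∑ m ∈ Finset.range N, (a (m + 2) - 2 * a (m + 1) + a m) * sin ((m + 1 : ℕ) * θ) +
      (a (N + 1) * sin (N * θ) - a N * sin ((N + 1 : ℕ) * θ)) := by
  induction N with
  | zero => simp [ha]
  | succ N ih =>
    rw [Finset.sum_Icc_succ_top (by omega), Finset.sum_range_succ, mul_add, ih]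
    have h1 : sin ((N + 1 + 1 : ℕ) * θ) =
        sin ((N + 1 : ℕ) * θ) * cos θ + cos ((N + 1 : ℕ) * θ) * sin θ := by
      rw [← sin_add]
      push_cast
      ring_nf
    have h2 : sin (N * θ) =
        sin ((N + 1 : ℕ) * θ) * cos θ - cos ((N + 1 : ℕ) * θ) * sin θ := by
      rw [← sin_sub]
      push_cast
      ring_nf
    rw [h1, h2]
    ring

lemma exists_limit_secondDiff {P : ℝ} (hP : 0 < P) {u : ℝ} (hu : 0 < sin (π * u)) :
    ∃ S : ℝ,
      Tendsto (fun N : ℕ => ∑ m ∈ Finset.Icc 1 N, cutCoeff P m * sin (m * (2 * π * u)))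
        atTop (nhds S) ∧ |S| ≤ 10 / P ^ 2 / (4 * sin (π * u) ^ 2) := by
  set θ := 2 * π * u with hθ
  have hc : 2 - 2 * cos θ = 4 * sin (π * u) ^ 2 := by
    have : θ = 2 * (π * u) := by ring
    rw [this, cos_two_mul, cos_sq']
    ring
  have hc0 : 0 < 2 - 2 * cos θ := by rw [hc]; positivity
  have hs : Summable fun m => |secondDiff P m| :=
    summable_of_sum_range_le (fun _ => abs_nonneg _) (sum_abs_secondDiff_le hP)
  have hb (m : ℕ) : ‖secondDiff P m * sin ((m + 1 : ℕ) * θ)‖ ≤ |secondDiff P m| := by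
    rw [norm_mul, Real.norm_eq_abs, Real.norm_eq_abs]
    exact mul_le_of_le_one_right (abs_nonneg _) (abs_sin_le_one _)
  have hs2 : Summable fun m : ℕ => secondDiff P m * sin ((m + 1 : ℕ) * θ) :=
    Summable.of_norm_bounded hs hb
  have hbd (b : ℕ → ℝ) (hb : Tendsto b atTop (nhds 0)) (x : ℕ → ℝ) :
      Tendsto (fun N => b N * sin (x N)) atTop (nhds 0) := by
    refine squeeze_zero_norm (fun N => ?_) (by simpa using hb.abs)
    rw [norm_mul, Real.norm_eq_abs, Real.norm_eq_abs]
    exact mul_le_of_le_one_right (abs_nonneg _) (abs_sin_le_one _)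
  have ht := (hs2.hasSum.tendsto_sum_nat.neg.add
    ((hbd _ ((tendsto_add_atTop_iff_nat 1).2 (tendsto_cutCoeff P)) fun N => N * θ).sub
      (hbd _ (tendsto_cutCoeff P) fun N => (N + 1 : ℕ) * θ))).div_const (2 - 2 * cos θ)
  refine ⟨_, ht.congr fun N => ?_, ?_⟩
  · rw [div_eq_iff hc0.ne', mul_comm (∑ m ∈ _, _)]
    exact (sum_by_parts_twice (cutCoeff P) (by simp [cutCoeff]) θ N).symm
  · rw [sub_self, add_zero, abs_div, abs_neg, abs_of_pos hc0, hc]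
    gcongr
    refine (tsum_of_norm_bounded hs.hasSum hb).trans ?_
    exact hs.tsum_le_of_sum_range_le (sum_abs_secondDiff_le hP)

lemma abs_sum_antitone_mul_sub_le (b c : ℕ → ℝ) {K : ℕ} (hb : ∀ m ≥ K, b (m + 1) ≤ b m)
    (hb0 : ∀ m, 0 ≤ b m) (hc : ∀ m, |c m| ≤ 1) {N : ℕ} (hN : K ≤ N) :
    |∑ m ∈ Finset.Ico K N, b m * (c m - c (m + 1))| ≤ 2 * b K := by
  have key : |∑ m ∈ Finset.Ico K N, b m * (c m - c (m + 1)) + b N * c N| ≤ 2 * b K - b N := by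
    induction N, hN using Nat.le_induction with
    | base =>
      simp only [Finset.Ico_self, Finset.sum_empty, zero_add, abs_mul, abs_of_nonneg (hb0 K)]
      nlinarith [mul_le_mul_of_nonneg_left (hc K) (hb0 K)]
    | succ N hN ih =>
      rw [Finset.sum_Ico_succ_top hN]
      have e : ∑ m ∈ Finset.Ico K N, b m * (c m - c (m + 1)) + b N * (c N - c (N + 1)) +
          b (N + 1) * c (N + 1) = (∑ m ∈ Finset.Ico K N, b m * (c m - c (m + 1)) + b N * c N) +
          -((b N - b (N + 1)) * c (N + 1)) := by ring
      rw [e]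
      refine (abs_add_le _ _).trans ?_
      have h := sub_nonneg.2 (hb N hN)
      rw [abs_neg, abs_mul, abs_of_nonneg h]
      nlinarith [mul_le_mul_of_nonneg_left (hc (N + 1)) h]
  have h2 : |b N * c N| ≤ b N := by
    rw [abs_mul, abs_of_nonneg (hb0 N)]
    exact mul_le_of_le_one_right (hb0 N) (hc N)
  have e : ∑ m ∈ Finset.Ico K N, b m * (c m - c (m + 1)) =
    (∑ m ∈ Finset.Ico K N, b m * (c m - c (m + 1)) + b N * c N) - b N * c N := by ring
  rw [e]
  exact (abs_sub _ _).trans (by linarith)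

lemma abs_sum_Ico_inv_mul_sin_le {u : ℝ} (hu : 0 < sin (π * u)) {K N : ℕ} (hK : 0 < K)
    (hN : K ≤ N) :
    |∑ m ∈ Finset.Ico K N, 1 / (m : ℝ) * sin (m * (2 * π * u))| ≤ 1 / K / sin (π * u) := by
  have h := abs_sum_antitone_mul_sub_le (fun m : ℕ => 1 / (m : ℝ))
    (fun m : ℕ => cos ((2 * m - 1) * (π * u))) (K := K)
    (fun m hm => one_div_le_one_div_of_le (by exact_mod_cast (by omega : 0 < m))
      (by exact_mod_cast Nat.le_succ m))
    (fun m => by positivity) (fun m => abs_cos_le_one _) hN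
  have e : ∑ m ∈ Finset.Ico K N, 1 / (m : ℝ) *
      (cos ((2 * m - 1) * (π * u)) - cos ((2 * (m + 1 : ℕ) - 1) * (π * u))) =
      2 * sin (π * u) * ∑ m ∈ Finset.Ico K N, 1 / (m : ℝ) * sin (m * (2 * π * u)) := by
    rw [Finset.mul_sum]
    refine Finset.sum_congr rfl fun m _ => ?_
    have h1 : (2 * m - 1) * (π * u) = m * (2 * π * u) - π * u := by ring
    have h2 : (2 * (m + 1 : ℕ) - 1) * (π * u) = m * (2 * π * u) + π * u := by
      push_cast
      ring
    rw [h1, h2, cos_sub, cos_add]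
    ring
  rw [e, abs_mul, abs_of_pos (by positivity : 0 < 2 * sin (π * u))] at h
  rw [le_div_iff₀ hu]
  linarith

/-- The chord bound for `sin` on `[0, π/3]`. -/
lemma sin_pi_mul_ge {u : ℝ} (h0 : 0 ≤ u) (h1 : u ≤ 1 / 3) : 3 * √3 / 2 * u ≤ sin (π * u) := by
  have h := strictConcaveOn_sin_Icc.concaveOn.2
    (⟨le_rfl, pi_pos.le⟩ : (0 : ℝ) ∈ Set.Icc 0 π)
    (⟨by positivity, by linarith [pi_pos]⟩ : π / 3 ∈ Set.Icc 0 π)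
    (by linarith : 0 ≤ 1 - 3 * u) (by linarith : 0 ≤ 3 * u) (by ring)
  simp only [smul_eq_mul, sin_zero, mul_zero, zero_add, sin_pi_div_three] at h
  rw [show 3 * u * (π / 3) = π * u by ring] at h
  linarith

lemma sqrt_three_div_two_le_sin {u : ℝ} (h0 : 1 / 3 ≤ u) (h1 : u ≤ 1 / 2) :
    √3 / 2 ≤ sin (π * u) := by
  rw [← sin_pi_div_three]
  apply sin_le_sin_of_le_of_le_pi_div_two <;> nlinarith [pi_pos]

lemma abs_limit_le_of_mul_lt {P u S : ℝ} (hP : 0 < P) (hu0 : 0 < u) (hu : u ≤ 1 / 3)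
    (hPu : P * u < 1 / 3)
    (hS : Tendsto (fun N : ℕ => ∑ m ∈ Finset.Icc 1 N, cutCoeff P m * sin (m * (2 * π * u)))
      atTop (nhds S)) :
    |S| ≤ 2 * π / 3 + 2 / √3 := by
  have h3 : 0 < √3 := by positivity
  have hsin := sin_pi_mul_ge hu0.le hu
  have hsin0 : 0 < sin (π * u) := lt_of_lt_of_le (by positivity) hsin
  obtain ⟨K, hKlt, hKge⟩ : ∃ K : ℕ, (K : ℝ) < 1 / (3 * u) ∧ 1 / (3 * u) ≤ (K + 1 : ℕ) := by
    refine ⟨⌈1 / (3 * u)⌉₊ - 1, ?_, ?_⟩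
    · have hpos : 0 < ⌈1 / (3 * u)⌉₊ := Nat.ceil_pos.2 (by positivity)
      exact Nat.lt_ceil.1 (by omega)
    · refine (Nat.le_ceil _).trans ?_
      exact_mod_cast (by omega)
  have hPK : P ≤ (K + 1 : ℕ) := by
    refine le_trans ?_ hKge
    rw [le_div_iff₀ (by positivity)]
    linarith
  have hhead : |∑ m ∈ Finset.Ico 1 (K + 1), cutCoeff P m * sin (m * (2 * π * u))| ≤
      2 * π / 3 := by
    have hterm : ∀ m ∈ Finset.Ico 1 (K + 1),
        |cutCoeff P m * sin (m * (2 * π * u))| ≤ 2 * π * u := by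
      intro m hm
      have hm0 : (0 : ℝ) < m := by exact_mod_cast (Finset.mem_Ico.1 hm).1
      rw [abs_mul, abs_of_nonneg (cutCoeff_nonneg P m)]
      have hs : |sin (m * (2 * π * u))| ≤ m * (2 * π * u) := by
        refine abs_sin_le_abs.trans (abs_of_nonneg (by positivity)).le
      calc cutCoeff P m * |sin (m * (2 * π * u))| ≤ 1 / m * (m * (2 * π * u)) :=
            mul_le_mul (cutCoeff_le P m) hs (abs_nonneg _) (by positivity)
        _ = 2 * π * u := by field_simp
    refine (Finset.abs_sum_le_sum_abs _ _).trans ((Finset.sum_le_card_nsmul _ _ _ hterm).trans ?_)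
    simp only [Nat.card_Ico, add_tsub_cancel_right, nsmul_eq_mul]
    rw [lt_div_iff₀ (by positivity)] at hKlt
    nlinarith [pi_pos]
  refine le_of_tendsto hS.abs ?_
  filter_upwards [eventually_ge_atTop K] with N hN
  have e : ∑ m ∈ Finset.Icc 1 N, cutCoeff P m * sin (m * (2 * π * u)) =
      ∑ m ∈ Finset.Ico 1 (K + 1), cutCoeff P m * sin (m * (2 * π * u)) +
      ∑ m ∈ Finset.Ico (K + 1) (N + 1), 1 / (m : ℝ) * sin (m * (2 * π * u)) := by
    rw [← Finset.Ico_add_one_right_eq_Icc,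
      ← Finset.sum_Ico_consecutive _ (by omega : 1 ≤ K + 1) (by omega : K + 1 ≤ N + 1)]
    congr 1
    refine Finset.sum_congr rfl fun m hm => ?_
    rw [cutCoeff_of_le hP (hPK.trans (by exact_mod_cast (Finset.mem_Ico.1 hm).1))]
  rw [e]
  refine (abs_add_le _ _).trans (add_le_add hhead ?_)
  refine (abs_sum_Ico_inv_mul_sin_le hsin0 (Nat.succ_pos K) (by omega)).trans ?_
  rw [div_le_iff₀ hsin0]
  have hK1 : 1 / ((K + 1 : ℕ) : ℝ) ≤ 3 * u := by
    have := one_div_le_one_div_of_le (by positivity) hKge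
    rwa [one_div_one_div] at this
  refine hK1.trans ?_
  calc 3 * u = 2 / √3 * (3 * √3 / 2 * u) := by field_simp
    _ ≤ 2 / √3 * sin (π * u) := by gcongr

lemma summable_GP {P u : ℝ} (hP : 1 < P) (h0 : 0 < u) (h1 : u < 1) :
    Summable fun n : ℤ => 1 / (1 + P ^ 2 * ((n : ℝ) + u) ^ 2) := by
  refine Summable.of_nonneg_of_le (fun n => by positivity) (fun n => ?_)
    ((Real.summable_one_div_int_add_rpow u 2).2 (by norm_num))
  have hn : (n : ℝ) + u ≠ 0 := by
    rcases le_or_gt 0 n with hn | hn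
    · have : (0 : ℝ) ≤ n := by exact_mod_cast hn
      linarith
    · have : (n : ℝ) ≤ -1 := by exact_mod_cast (by omega : n ≤ -1)
      linarith
  rw [rpow_two, sq_abs]
  have h2 : 0 < ((n : ℝ) + u) ^ 2 := by positivity
  apply one_div_le_one_div_of_le h2
  have h3 : 1 ≤ P ^ 2 := one_le_pow₀ hP.le
  nlinarith [mul_le_mul_of_nonneg_right h3 h2.le]

lemma GP_nonneg (P u : ℝ) : 0 ≤ GP P u := tsum_nonneg fun n => by positivity

lemma GP_ge_two_terms {P u : ℝ} (hP : 1 < P) (h0 : 0 < u) (h1 : u < 1) :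
    1 / (1 + P ^ 2 * u ^ 2) + 1 / (1 + P ^ 2 * (1 - u) ^ 2) ≤ GP P u := by
  have h := (summable_GP hP h0 h1).sum_le_tsum {0, -1} (fun n _ => by positivity)
  rw [Finset.sum_pair (by norm_num)] at h
  refine le_trans (le_of_eq ?_) h
  push_cast
  ring_nf

lemma GP_one_sub (P u : ℝ) : GP P (1 - u) = GP P u := by
  unfold GP
  rw [← (Equiv.subLeft (-1 : ℤ)).tsum_eq]
  refine tsum_congr fun n => ?_
  simp only [Equiv.subLeft_apply]
  push_cast
  ring_nf

lemma const_ge : (3.78 : ℝ) ≤ (4 * π ^ ((5 : ℝ) / 2) + 5) / (2 * π ^ 2) := by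
  have h1 := pi_gt_d2
  have h2 := pi_lt_d2
  have e : π ^ ((5 : ℝ) / 2) = π ^ 2 * √π := by
    rw [sqrt_eq_rpow, ← rpow_natCast, ← rpow_add pi_pos]
    norm_num
  have hs : 1.77 ≤ √π := by
    apply le_sqrt_of_sq_le
    norm_num at h1 ⊢
    linarith
  rw [e, le_div_iff₀ (by positivity)]
  nlinarith [mul_le_mul_of_nonneg_left hs (sq_nonneg π)]

lemma exists_limit_le_half {u P : ℝ} (h0 : 0 < u) (h1 : u ≤ 1 / 2) (hP : 1 < P) :
    ∃ S : ℝ,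
      Tendsto (fun N : ℕ => ∑ m ∈ Finset.Icc 1 N, cutCoeff P m * sin (m * (2 * π * u)))
        atTop (nhds S) ∧ |S| ≤ 3.78 * GP P u := by
  have hP0 : 0 < P := by linarith
  have hsin : 0 < sin (π * u) := sin_pos_of_pos_of_lt_pi (by positivity) (by nlinarith [pi_pos])
  obtain ⟨S, hS, hle⟩ := exists_limit_secondDiff hP0 hsin
  refine ⟨S, hS, ?_⟩
  have hG := GP_ge_two_terms hP h0 (by linarith)
  have hG1 : 1 / (1 + P ^ 2 * u ^ 2) ≤ GP P u := by
    have : 0 ≤ 1 / (1 + P ^ 2 * (1 - u) ^ 2) := by positivity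
    linarith
  have hsq : √3 ^ 2 = 3 := sq_sqrt (by norm_num)
  rcases lt_or_ge (P * u) (1 / 3) with hx | hx
  · have hA := abs_limit_le_of_mul_lt hP0 h0 (by nlinarith) hx hS
    have h3 : 2 / √3 ≤ 1.16 := by
      rw [div_le_iff₀ (by positivity)]
      nlinarith [sqrt_nonneg (3 : ℝ)]
    have hB : 0.9 ≤ 1 / (1 + P ^ 2 * u ^ 2) := by
      rw [le_div_iff₀ (by positivity)]
      nlinarith [mul_pos hP0 h0]
    linarith [pi_lt_d2]
  rcases le_or_gt u (1 / 3) with hu | hu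
  · have hs := sin_pi_mul_ge h0.le hu
    have hs2 : 6.75 * u ^ 2 ≤ sin (π * u) ^ 2 := by
      have := pow_le_pow_left₀ (by positivity) hs 2
      nlinarith
    have hB : 10 / P ^ 2 / (4 * sin (π * u) ^ 2) ≤ 3.78 * (1 / (1 + P ^ 2 * u ^ 2)) := by
      rw [mul_one_div, div_div, div_le_div_iff₀ (by positivity) (by positivity)]
      nlinarith [mul_le_mul_of_nonneg_left hs2 (sq_nonneg P)]
    linarith
  · have hs := sqrt_three_div_two_le_sin hu.le h1
    have hs2 : 3 / 4 ≤ sin (π * u) ^ 2 := by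
      have := pow_le_pow_left₀ (by positivity) hs 2
      nlinarith
    have hB : 10 / P ^ 2 / (4 * sin (π * u) ^ 2) ≤ 10 / P ^ 2 / 3 := by
      gcongr
      linarith
    have hC (v : ℝ) (hv0 : 0 < v) (hv : v ≤ 2 / 3) :
        9 / 13 / P ^ 2 ≤ 1 / (1 + P ^ 2 * v ^ 2) := by
      rw [div_div, div_le_div_iff₀ (by positivity) (by positivity)]
      have : v ^ 2 ≤ 4 / 9 := by nlinarith
      nlinarith [mul_le_mul_of_nonneg_left this (sq_nonneg P)]
    have hC1 := hC u h0 (by linarith)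
    have hC2 := hC (1 - u) (by linarith) (by linarith)
    have hQ : 0 < 1 / P ^ 2 := by positivity
    have e1 : 10 / P ^ 2 / 3 = 10 / 3 * (1 / P ^ 2) := by ring
    have e2 : 9 / 13 / P ^ 2 = 9 / 13 * (1 / P ^ 2) := by ring
    linarith

theorem S_uP_le_GP (u : ℝ) (hu : u ∈ Set.Icc (0 : ℝ) 1) (P : ℝ) (hP : 1 < P) :
    ∃ S : ℝ,
      Tendsto (fun N : ℕ =>
          ∑ m ∈ Finset.Icc 1 N, (1 / (m : ℝ)) * ωcut (m / P) * Real.sin (2 * π * m * u))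
        atTop (nhds S) ∧
      |S| ≤ (4 * π ^ ((5 : ℝ) / 2) + 5) / (2 * π ^ 2) * GP P u := by
  have hconst := mul_le_mul_of_nonneg_right const_ge (GP_nonneg P u)
  rcases hu.1.eq_or_lt with rfl | h0
  · exact ⟨0, by simp, by simpa using le_trans (by linarith [GP_nonneg P 0]) hconst⟩
  rcases hu.2.eq_or_lt with rfl | h1
  · refine ⟨0, ?_, by simpa using le_trans (by linarith [GP_nonneg P 1]) hconst⟩
    refine tendsto_const_nhds.congr fun N => (Finset.sum_eq_zero fun m _ => ?_).symm
    rw [show 2 * π * m * 1 = (2 * m : ℕ) * π by push_cast; ring, sin_nat_mul_pi, mul_zero]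
  rcases le_total u (1 / 2) with h | h
  · obtain ⟨S, hS, hle⟩ := exists_limit_le_half h0 h hP
    refine ⟨S, hS.congr fun N => Finset.sum_congr rfl fun m _ => ?_, hle.trans hconst⟩
    rw [cutCoeff]
    ring_nf
  · obtain ⟨S, hS, hle⟩ := exists_limit_le_half (u := 1 - u) (by linarith) (by linarith) hP
    rw [GP_one_sub] at hle
    refine ⟨-S, hS.neg.congr fun N => ?_, by rw [abs_neg]; exact hle.trans hconst⟩
    rw [← Finset.sum_neg_distrib]
    refine Finset.sum_congr rfl fun m _ => ?_
    rw [show m * (2 * π * (1 - u)) = m * (2 * π) - 2 * π * m * u by ring,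
      sin_nat_mul_two_pi_sub, cutCoeff]
    ring
end
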